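/- For every real γ > 0, every R ≥ 0, every real ζ and each sign ε ∈ {−1, +1}: Σ_{j=0}^∞ (j+γ) ε^j I_{j+γ}(R) C_j^γ(cos ζ) = (R/2)^γ · e^{ε R cos ζ} / Γ(γ). -/

import Mathlib

/-- Modified Bessel function of the first kind of real order `α ≥ 0`. -/
noncomputable def besselI (α R : ℝ) : ℝ :=
  ∑' m : ℕ, (R / 2) ^ (2 * (m : ℝ) + α) / (Nat.factorial m * Real.Gamma ((m : ℝ) + α + 1))

/-- Gegenbauer polynomial `C_j^ν(x)` for real `ν > 0`. -/
noncomputable def gegenbauerC (ν : ℝ) (j : ℕ) (x : ℝ) : ℝ :=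
  ∑ k ∈ Finset.range (j / 2 + 1),
    (-1 : ℝ) ^ k * Real.Gamma (ν + (j : ℝ) - (k : ℝ)) /
      (Real.Gamma ν * Nat.factorial k * Nat.factorial (j - 2 * k)) * (2 * x) ^ (j - 2 * k)

open Finset in
/-- Partial sums of the telescoping series `∑ (-1)^k (a+2k) Γ(a+k) / (k! (p-k)! Γ(a+p+k+1))`. -/
theorem sum_range_alternating_gamma {a : ℝ} (ha : 0 < a) {p K : ℕ} (hp : 0 < p) (hK : K ≤ p) :
    ∑ k ∈ range K, (-1 : ℝ) ^ k * (a + 2 * k) * Real.Gamma (a + k) /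
        (k.factorial * (p - k).factorial * Real.Gamma (a + p + k + 1)) =
      -((-1 : ℝ) ^ K * K * Real.Gamma (a + K) /
        (K.factorial * (p - K).factorial * p * Real.Gamma (a + p + K))) := by
  induction K with
  | zero => simp
  | succ K ih =>
    rw [sum_range_succ, ih (by omega)]
    obtain ⟨q, rfl⟩ : ∃ q, p = K + 1 + q := ⟨p - (K + 1), by omega⟩
    rw [show K + 1 + q - K = q + 1 by omega, show K + 1 + q - (K + 1) = q by omega]
    have h₁ : Real.Gamma (a + (K + 1 : ℕ)) = (a + K) * Real.Gamma (a + K) := by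
      rw [← Real.Gamma_add_one (by positivity)]; push_cast; ring_nf
    have h₂ : Real.Gamma (a + (K + 1 + q : ℕ) + K + 1) =
        (a + (K + 1 + q : ℕ) + K) * Real.Gamma (a + (K + 1 + q : ℕ) + K) :=
      Real.Gamma_add_one (by positivity)
    have h₃ : a + (K + 1 + q : ℕ) + (K + 1 : ℕ) = a + (K + 1 + q : ℕ) + K + 1 := by
      push_cast; ring
    have h₄ : 0 < Real.Gamma (a + (K + 1 + q : ℕ) + K) := Real.Gamma_pos_of_pos (by positivity)
    rw [h₃, h₁, h₂]
    generalize Real.Gamma (a + (K + 1 + q : ℕ) + K) = G at *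
    generalize Real.Gamma (a + K) = H
    simp only [Nat.factorial_succ, pow_succ]
    push_cast
    field_simp
    ring

open Finset in
theorem sum_alternating_gamma_eq_ite {a : ℝ} (ha : 0 < a) (p : ℕ) :
    ∑ k ∈ range (p + 1), (-1 : ℝ) ^ k * (a + 2 * k) * Real.Gamma (a + k) /
        (k.factorial * (p - k).factorial * Real.Gamma (a + p + k + 1)) =
      if p = 0 then 1 else 0 := by
  rcases Nat.eq_zero_or_pos p with rfl | hp
  · have := Real.Gamma_pos_of_pos ha
    have h : a * Real.Gamma a ≠ 0 := by positivity
    simp [Real.Gamma_add_one ha.ne', h]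
  · rw [sum_range_succ, sum_range_alternating_gamma ha hp le_rfl, if_neg hp.ne',
      Real.Gamma_add_one (by positivity)]
    have : 0 < Real.Gamma (a + p + p) := Real.Gamma_pos_of_pos (by positivity)
    field_simp
    ring

theorem min_mul_gamma_le_gamma_add_nat {γ s : ℝ} (hγ : 0 < γ) (hs : γ ≤ s) (i : ℕ) :
    min γ 1 * Real.Gamma s ≤ Real.Gamma (s + i) := by
  have hs0 : 0 < s := hγ.trans_le hs
  have hG := Real.Gamma_pos_of_pos hs0
  induction i with
  | zero => simpa using mul_le_of_le_one_left hG.le (min_le_right γ 1)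
  | succ i ih =>
    rw [show s + (i + 1 : ℕ) = s + i + 1 by push_cast; ring, Real.Gamma_add_one (by positivity)]
    rcases Nat.eq_zero_or_pos i with rfl | hi
    · simpa using mul_le_mul_of_nonneg_right ((min_le_left γ 1).trans hs) hG.le
    · have : (1 : ℝ) ≤ i := by exact_mod_cast hi
      exact ih.trans (le_mul_of_one_le_left (Real.Gamma_pos_of_pos (by positivity)).le
        (by linarith))

/-- The term of the triple series obtained by expanding the Bessel functions (index `m`) and the
Gegenbauer polynomials (index `k`, with `j = n + 2 * k`). -/
noncomputable def gegenbauerBesselTerm (γ r y : ℝ) (n k m : ℕ) : ℝ :=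
  (-1) ^ k * (n + γ + 2 * k) * Real.Gamma (n + γ + k) / Real.Gamma (m + (n + 2 * k + γ) + 1) *
    (y ^ n / n.factorial * ((r ^ 2) ^ k / k.factorial * ((r ^ 2) ^ m / m.factorial)))

theorem abs_gegenbauerBesselTerm_le {γ : ℝ} (hγ : 0 < γ) (r y : ℝ) (n k m : ℕ) :
    |gegenbauerBesselTerm γ r y n k m| ≤
      (min γ 1)⁻¹ * (|y| ^ n / n.factorial *
        ((r ^ 2) ^ k / k.factorial * ((r ^ 2) ^ m / m.factorial))) := by
  have hc : 0 < min γ 1 := lt_min hγ one_pos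
  have h₁ : 0 < Real.Gamma (n + γ + k) := Real.Gamma_pos_of_pos (by positivity)
  have h₂ : 0 < Real.Gamma (m + (n + 2 * k + γ) + 1) := Real.Gamma_pos_of_pos (by positivity)
  rw [gegenbauerBesselTerm, abs_mul]
  have hy : |y ^ n / n.factorial * ((r ^ 2) ^ k / k.factorial * ((r ^ 2) ^ m / m.factorial))| =
      |y| ^ n / n.factorial * ((r ^ 2) ^ k / k.factorial * ((r ^ 2) ^ m / m.factorial)) := by
    rw [abs_mul, abs_div, abs_pow, Nat.abs_cast,
      abs_of_nonneg (a := (r ^ 2) ^ k / k.factorial * ((r ^ 2) ^ m / m.factorial))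
        (by positivity)]
  rw [hy]
  gcongr
  rw [abs_div, abs_mul, abs_mul, abs_pow, abs_neg, abs_one, one_pow, one_mul,
    abs_of_pos h₁, abs_of_pos h₂, abs_of_pos (by positivity), inv_eq_one_div,
    div_le_div_iff₀ h₂ hc, one_mul]
  have h := min_mul_gamma_le_gamma_add_nat hγ (s := n + γ + k)
    (by linarith [n.cast_nonneg (α := ℝ), k.cast_nonneg (α := ℝ)]) (k + m)
  have h₃ : (n : ℝ) + γ + k + (k + m : ℕ) = m + (n + 2 * k + γ) := by push_cast; ring
  rw [h₃] at h
  rw [Real.Gamma_add_one (by positivity), mul_assoc, mul_comm (Real.Gamma _)]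
  exact mul_le_mul (by linarith [m.cast_nonneg (α := ℝ)]) h (by positivity) (by positivity)

theorem summable_gegenbauerBesselTerm {γ : ℝ} (hγ : 0 < γ) (r y : ℝ) :
    Summable fun t : ℕ × ℕ × ℕ => gegenbauerBesselTerm γ r y t.1 t.2.1 t.2.2 := by
  have hr := Real.summable_pow_div_factorial (r ^ 2)
  have hr0 : ∀ i : ℕ, 0 ≤ (r ^ 2) ^ i / (i.factorial : ℝ) := fun i => by positivity
  have hrr := hr.mul_of_nonneg hr hr0 hr0
  have h := (Real.summable_pow_div_factorial |y|).mul_of_nonneg hrr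
    (fun i => by positivity) (fun t => mul_nonneg (hr0 _) (hr0 _))
  exact Summable.of_norm_bounded (h.mul_left (min γ 1)⁻¹)
    fun t => abs_gegenbauerBesselTerm_le hγ r y t.1 t.2.1 t.2.2

theorem sum_gegenbauerBesselTerm_antidiagonal {γ : ℝ} (hγ : 0 < γ) (r y : ℝ) (n p : ℕ) :
    ∑ k ∈ Finset.range (p + 1), gegenbauerBesselTerm γ r y n k (p - k) =
      if p = 0 then y ^ n / n.factorial else 0 := by
  have h : ∀ k ∈ Finset.range (p + 1), gegenbauerBesselTerm γ r y n k (p - k) =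
      y ^ n / n.factorial * (r ^ 2) ^ p *
        ((-1 : ℝ) ^ k * (n + γ + 2 * k) * Real.Gamma (n + γ + k) /
          (k.factorial * (p - k).factorial * Real.Gamma (n + γ + p + k + 1))) := by
    intro k hk
    obtain ⟨q, rfl⟩ : ∃ q, p = k + q := ⟨p - k, by grind⟩
    rw [gegenbauerBesselTerm, Nat.add_sub_cancel_left,
      show (q : ℝ) + (n + 2 * k + γ) + 1 = n + γ + (k + q : ℕ) + k + 1 by push_cast; ring, pow_add]
    field_simp
  rw [Finset.sum_congr rfl h, ← Finset.mul_sum, sum_alternating_gamma_eq_ite (by positivity)]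
  split_ifs with hp <;> simp [hp]

theorem tsum_gegenbauerBesselTerm {γ : ℝ} (hγ : 0 < γ) (r y : ℝ) :
    ∑' t : ℕ × ℕ × ℕ, gegenbauerBesselTerm γ r y t.1 t.2.1 t.2.2 = Real.exp y := by
  let g : ℕ × ℕ × ℕ → ℝ := fun t =>
    if t.2.2 ≤ t.2.1 then gegenbauerBesselTerm γ r y t.1 t.2.2 (t.2.1 - t.2.2) else 0
  let i : ℕ × ℕ × ℕ → ℕ × ℕ × ℕ := fun t => (t.1, t.2.1 + t.2.2, t.2.1)
  have hi : Function.Injective i := by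
    rintro ⟨n, k, m⟩ ⟨n', k', m'⟩ h
    simp only [i, Prod.mk.injEq] at h ⊢
    omega
  have hg : ∀ t ∉ Set.range i, g t = 0 := by
    rintro ⟨n, p, k⟩ h
    refine if_neg fun hk => h ⟨(n, k, p - k), ?_⟩
    simp only [i, Prod.mk.injEq, true_and, and_true]
    exact Nat.add_sub_cancel' hk
  have hgi : g ∘ i = fun t => gegenbauerBesselTerm γ r y t.1 t.2.1 t.2.2 := by
    funext t; simp [g, i]
  have hs : Summable g := (hi.summable_iff hg).1 (hgi ▸ summable_gegenbauerBesselTerm hγ r y)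
  have hpk : ∀ n p : ℕ, ∑' k, g (n, p, k) = if p = 0 then y ^ n / n.factorial else 0 := by
    intro n p
    rw [← sum_gegenbauerBesselTerm_antidiagonal hγ r y n p,
      tsum_eq_sum (s := Finset.range (p + 1)) (fun k hk => if_neg (by grind))]
    exact Finset.sum_congr rfl fun k hk => if_pos (by grind)
  calc _ = ∑' t, g t := by
        rw [← hgi]
        exact hi.tsum_eq fun t ht => by_contra fun h => ht (hg t h)
    _ = ∑' n, ∑' p, ∑' k, g (n, p, k) := by
        rw [hs.tsum_prod]
        exact tsum_congr fun n => (hs.prod_factor n).tsum_prod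
    _ = ∑' n : ℕ, y ^ n / n.factorial := by
        simp only [hpk, tsum_ite_eq]
    _ = Real.exp y := by rw [Real.exp_eq_exp_ℝ, NormedSpace.exp_eq_tsum_div]

theorem besselI_eq_rpow_mul_tsum {γ R : ℝ} (hγ : 0 < γ) (hR : 0 ≤ R) (j : ℕ) :
    besselI (j + γ) R = (R / 2) ^ γ * ∑' m : ℕ, (R / 2) ^ (2 * m + j) /
      (m.factorial * Real.Gamma (m + (j + γ) + 1)) := by
  rw [besselI, ← tsum_mul_left]
  refine tsum_congr fun m => ?_
  rw [show 2 * (m : ℝ) + (j + γ) = γ + (2 * m + j : ℕ) by push_cast; ring,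
    Real.rpow_add_of_nonneg (by positivity) hγ.le (by positivity), Real.rpow_natCast]
  ring

/-- The Gegenbauer coefficient `k`, extended by zero to all `k`, without the factor `1 / Γ(ν)`. -/
noncomputable def gegenbauerSummand (ν : ℝ) (j : ℕ) (x : ℝ) (k : ℕ) : ℝ :=
  if 2 * k ≤ j then (-1) ^ k * Real.Gamma (ν + j - k) /
    (k.factorial * (j - 2 * k).factorial) * (2 * x) ^ (j - 2 * k) else 0

theorem gegenbauerC_eq_tsum (ν : ℝ) (j : ℕ) (x : ℝ) :
    gegenbauerC ν j x = (Real.Gamma ν)⁻¹ * ∑' k, gegenbauerSummand ν j x k := by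
  have h : ∀ k ∉ Finset.range (j / 2 + 1), gegenbauerSummand ν j x k = 0 :=
    fun k hk => if_neg (by grind)
  rw [gegenbauerC, tsum_eq_sum h, Finset.mul_sum]
  refine Finset.sum_congr rfl fun k hk => ?_
  rw [gegenbauerSummand, if_pos (by grind)]
  simp only [div_eq_mul_inv, mul_inv]
  ring

theorem tsum_besselI_gegenbauer_series {γ : ℝ} (hγ : 0 < γ) (r x : ℝ) {ε : ℝ} (hε : ε ^ 2 = 1) :
    ∑' j : ℕ, (j + γ) * ε ^ j * (∑' k, gegenbauerSummand γ j x k) *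
        (∑' m : ℕ, r ^ (2 * m + j) / (m.factorial * Real.Gamma (m + (j + γ) + 1))) =
      Real.exp (2 * ε * r * x) := by
  let b : ℕ → ℕ → ℝ := fun j m => r ^ (2 * m + j) / (m.factorial * Real.Gamma (m + (j + γ) + 1))
  let g : ℕ × ℕ × ℕ → ℝ := fun t =>
    (t.1 + γ) * ε ^ t.1 * gegenbauerSummand γ t.1 x t.2.1 * b t.1 t.2.2
  let i : ℕ × ℕ × ℕ → ℕ × ℕ × ℕ := fun t => (t.1 + 2 * t.2.1, t.2.1, t.2.2)
  have hi : Function.Injective i := by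
    rintro ⟨n, k, m⟩ ⟨n', k', m'⟩ h
    simp only [i, Prod.mk.injEq] at h ⊢
    omega
  have hg : ∀ t ∉ Set.range i, g t = 0 := by
    rintro ⟨j, k, m⟩ h
    have hk : ¬ 2 * k ≤ j := fun hk => h ⟨(j - 2 * k, k, m), by
      simp only [i, Prod.mk.injEq, and_true]
      exact Nat.sub_add_cancel hk⟩
    simp [g, gegenbauerSummand, hk]
  have hgi : g ∘ i = fun t => gegenbauerBesselTerm γ r (2 * ε * r * x) t.1 t.2.1 t.2.2 := by
    funext ⟨n, k, m⟩
    have hεk : ε ^ (n + 2 * k) = ε ^ n := by rw [pow_add, pow_mul, hε, one_pow, mul_one]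
    simp only [Function.comp_apply, g, i, b, gegenbauerSummand, gegenbauerBesselTerm, hεk,
      Nat.le_add_left, if_true, Nat.add_sub_cancel]
    rw [show γ + ((n + 2 * k : ℕ) : ℝ) - k = n + γ + k by push_cast; ring]
    push_cast
    simp only [pow_add, pow_mul, mul_pow, div_eq_mul_inv, mul_inv]
    ring
  have hs : Summable g := (hi.summable_iff hg).1 (hgi ▸ summable_gegenbauerBesselTerm hγ r _)
  calc _ = ∑' j, ∑' k, ∑' m, g (j, k, m) := by
        refine tsum_congr fun j => ?_
        simp only [g, tsum_mul_left, tsum_mul_right, b]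
    _ = ∑' t, g t := by
        rw [hs.tsum_prod]
        exact tsum_congr fun j => (hs.prod_factor j).tsum_prod.symm
    _ = _ := by
        rw [← tsum_gegenbauerBesselTerm hγ r, ← hgi]
        exact (hi.tsum_eq fun t ht => by_contra fun h => ht (hg t h)).symm

theorem stmt19 (γ : ℝ) (hγ : 0 < γ) (R : ℝ) (hR : 0 ≤ R) (ζ : ℝ)
    (ε : ℝ) (hε : ε = -1 ∨ ε = 1) :
    ∑' j : ℕ, ((j : ℝ) + γ) * ε ^ j * besselI ((j : ℝ) + γ) R *
        gegenbauerC γ j (Real.cos ζ) =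
      (R / 2) ^ γ * Real.exp (ε * R * Real.cos ζ) / Real.Gamma γ := by
  have hε2 : ε ^ 2 = 1 := by rcases hε with rfl | rfl <;> norm_num
  rw [show ε * R * Real.cos ζ = 2 * ε * (R / 2) * Real.cos ζ by ring,
    ← tsum_besselI_gegenbauer_series hγ (R / 2) (Real.cos ζ) hε2, mul_div_right_comm,
    ← tsum_mul_left]
  refine tsum_congr fun j => ?_
  rw [besselI_eq_rpow_mul_tsum hγ hR, gegenbauerC_eq_tsum]
  ring
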